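/- Let Ω be a bounded manifold of class C¹ in ℝ^N and let G be a compact subgroup of O(N). Let x ∈ Ω and set δ = dim O^x_G with δ ≥ 1. Then there exists a coordinate chart (A, φ) of Ω at x, with φ : ℝ^N → ℝ^N a C¹ diffeomorphism, such that: (1) φ(A) = U × V, where U is an open subset of ℝ^δ and V is an open subset of ℝ^{N−δ}; and (2) for all y ∈ A, U × Π₂(φ(y)) ⊂ φ(O^y_G ∩ A), where Π₂ : ℝ^δ × ℝ^{N−δ} → ℝ^{N−δ} is the projection onto the second factor. -/

import Mathlib

open MeasureTheory Metric Bornology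

noncomputable section

/-- `E n` is Euclidean space `ℝ^n`. -/
abbrev E (n : ℕ) : Type := EuclideanSpace ℝ (Fin n)

/-- The orbit `O^x_G = {g x : g ∈ G}` of a point `x ∈ ℝ^n` under a subgroup `G` of the
orthogonal group `O(n)`. -/
def orbitSet {n : ℕ} (G : Subgroup (Matrix.orthogonalGroup (Fin n) ℝ)) (x : E n) :
    Set (E n) :=
  {y | ∃ g ∈ G, Matrix.mulVec (g : Matrix (Fin n) (Fin n) ℝ) x = y}

open Filter Topology NormedSpace

/-- The elements whose one-parameter group stays in `K`. -/
def oneParamDirections {𝔸 : Type*} [NormedRing 𝔸] [NormedAlgebra ℝ 𝔸] (K : Set 𝔸) : Set 𝔸 :=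
  {X | ∀ t : ℝ, exp (t • X) ∈ K}

section
variable {𝔸 : Type*} [NormedRing 𝔸] [NormedAlgebra ℝ 𝔸] [FiniteDimensional ℝ 𝔸]

theorem mem_oneParamDirections_of_tendsto {K : Submonoid 𝔸}
    (hKc : IsClosed (K : Set 𝔸))
    (hKinv : ∀ a ∈ K, ∃ b ∈ K, a * b = 1 ∧ b * a = 1)
    {ι : Type*} {l : Filter ι} [l.NeBot] {Z : ι → 𝔸} {c : ι → ℝ}
    {X : 𝔸} (hZ : Tendsto Z l (𝓝 0)) (hK : ∀ᶠ n in l, exp (Z n) ∈ K)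
    (hX : Tendsto (fun n => c n • Z n) l (𝓝 X)) :
    X ∈ oneParamDirections (K : Set 𝔸) := by
  have : CompleteSpace 𝔸 := FiniteDimensional.complete ℝ 𝔸
  let +nondep : NormedAlgebra ℚ 𝔸 := .restrictScalars ℚ ℝ 𝔸
  intro t
  have h1 : Tendsto (fun n => ⌊t * c n⌋ • Z n) l (𝓝 (t • X)) := by
    have h2 : Tendsto (fun n => Int.fract (t * c n) • Z n) l (𝓝 0) := by
      refine squeeze_zero_norm (a := fun n => ‖Z n‖) (fun n => ?_) (by simpa using hZ.norm)
      rw [norm_smul, Real.norm_of_nonneg (Int.fract_nonneg _)]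
      exact mul_le_of_le_one_left (norm_nonneg _) (Int.fract_lt_one _).le
    have h3 := (hX.const_smul t).sub h2
    rw [sub_zero] at h3
    refine h3.congr fun n => ?_
    rw [smul_smul, ← sub_smul, Int.self_sub_fract, Int.cast_smul_eq_zsmul]
  have h4 : Tendsto (fun n => exp (⌊t * c n⌋ • Z n)) l (𝓝 (exp (t • X))) :=
    ((exp_continuous (𝔸 := 𝔸)).tendsto _).comp h1
  refine hKc.mem_of_tendsto h4 (hK.mono fun n hn => ?_)
  have hneg : exp (-Z n) ∈ K := by
    obtain ⟨b, hb, hab, hba⟩ := hKinv _ hn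
    have : exp (-Z n) * exp (Z n) = 1 := by
      rw [← exp_add_of_commute (Commute.neg_left (Commute.refl (Z n)))]; simp
    have : exp (-Z n) = b := by
      calc exp (-Z n) = exp (-Z n) * (exp (Z n) * b) := by rw [hab, mul_one]
        _ = b := by rw [← mul_assoc, this, one_mul]
    rwa [this]
  obtain ⟨m, hm | hm⟩ := Int.eq_nat_or_neg ⌊t * c n⌋
  · rw [hm, natCast_zsmul, exp_nsmul]
    exact pow_mem hn m
  · rw [hm, neg_smul, natCast_zsmul, ← smul_neg, exp_nsmul]
    exact pow_mem hneg m

theorem add_mem_oneParamDirections {K : Submonoid 𝔸}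
    (hKc : IsClosed (K : Set 𝔸))
    (hKinv : ∀ a ∈ K, ∃ b ∈ K, a * b = 1 ∧ b * a = 1) {X Y : 𝔸}
    (hX : X ∈ oneParamDirections (K : Set 𝔸))
    (hY : Y ∈ oneParamDirections (K : Set 𝔸)) :
    X + Y ∈ oneParamDirections (K : Set 𝔸) := by
  have : CompleteSpace 𝔸 := FiniteDimensional.complete ℝ 𝔸
  have he : HasStrictFDerivAt (exp : 𝔸 → 𝔸)
      ((ContinuousLinearEquiv.refl ℝ 𝔸 : 𝔸 ≃L[ℝ] 𝔸) : _ →L[ℝ] _) 0 :=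
    hasStrictFDerivAt_exp_zero
  set log := he.localInverse
  have hl : HasStrictFDerivAt log (ContinuousLinearMap.id ℝ 𝔸) 1 := by
    simpa using he.to_localInverse
  have hlog1 : log 1 = 0 := by
    simpa using he.localInverse_apply_image
  have hd : ∀ W : 𝔸, HasFDerivAt (fun s : ℝ => exp (s • W))
      ((ContinuousLinearMap.id ℝ ℝ).smulRight W) 0 := fun W => by
    have h0 : HasFDerivAt (exp : 𝔸 → 𝔸)
      (1 : 𝔸 →L[ℝ] 𝔸) ((0 : ℝ) • W) := by
      rw [zero_smul]; exact hasFDerivAt_exp_zero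
    exact h0.comp (0 : ℝ) ((ContinuousLinearMap.id ℝ ℝ).smulRight W).hasFDerivAt
  have hm := (hd X).mul' (hd Y)
  have hcomp : HasFDerivAt (fun s : ℝ => log (exp (s • X) * exp (s • Y)))
      ((ContinuousLinearMap.id ℝ ℝ).smulRight (X + Y)) 0 := by
    have h1 : HasFDerivAt log (ContinuousLinearMap.id ℝ 𝔸)
      (exp ((0 : ℝ) • X) * exp ((0 : ℝ) • Y)) := by simpa using hl.hasFDerivAt
    refine (h1.comp (0 : ℝ) hm).congr_fderiv ?_
    ext1
    simp [add_comm]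
  have hlim := hcomp.lim_real 1
  have hc0 : Tendsto (fun c : ℝ => 0 + c⁻¹ • (1 : ℝ)) atTop (𝓝 0) := by
    simpa using tendsto_inv_atTop_zero
  simp only [zero_smul, exp_zero, mul_one, hlog1, sub_zero] at hlim
  refine mem_oneParamDirections_of_tendsto hKc hKinv (l := atTop) (c := id)
    (Z := fun c : ℝ => log (exp ((0 + c⁻¹ • (1 : ℝ)) • X) * exp ((0 + c⁻¹ • (1 : ℝ)) • Y))) ?_ ?_
    (by simpa using hlim)
  · have := hcomp.continuousAt.tendsto.comp hc0
    simpa [hlog1, Function.comp_def] using this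
  · have h1 : Tendsto (fun s : ℝ => exp (s • X) * exp (s • Y)) (𝓝 0) (𝓝 (exp 0)) := by
      have := hm.continuousAt.tendsto
      simp only [Pi.mul_apply, zero_smul, exp_zero, mul_one] at this ⊢
      exact this
    refine (hc0.eventually (h1.eventually he.eventually_right_inverse)).mono fun c hc => ?_
    rw [hc]
    exact mul_mem (hX _) (hY _)

/-- The Lie algebra of a closed group `K` of linear endomorphisms. -/
def lieDirections (K : Submonoid 𝔸) (hKc : IsClosed (K : Set 𝔸))
    (hKinv : ∀ a ∈ K, ∃ b ∈ K, a * b = 1 ∧ b * a = 1) : Submodule ℝ 𝔸 where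
  carrier := oneParamDirections (K : Set 𝔸)
  add_mem' := add_mem_oneParamDirections hKc hKinv
  zero_mem' := fun t => by simp [one_mem]
  smul_mem' := fun c X hX t => by rw [smul_smul]; exact hX _

theorem exp_mem_of_mem_lieDirections {K : Submonoid 𝔸}
    {hKc : IsClosed (K : Set 𝔸)}
    {hKinv : ∀ a ∈ K, ∃ b ∈ K, a * b = 1 ∧ b * a = 1} {X : 𝔸}
    (hX : X ∈ lieDirections K hKc hKinv) : exp X ∈ K := by
  simpa using hX 1

theorem hasStrictFDerivAt_exp_mul_exp_mul_exp {F : Type*} [NormedAddCommGroup F]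
    [NormedSpace ℝ F] (A B C : F →L[ℝ] 𝔸) :
    HasStrictFDerivAt (fun p => exp (A p) * exp (B p) * exp (C p)) (A + B + C) 0 := by
  have : CompleteSpace 𝔸 := FiniteDimensional.complete ℝ 𝔸
  have hd : ∀ A : F →L[ℝ] 𝔸, HasStrictFDerivAt (fun p => exp (A p)) A 0 := fun A => by
    have h0 : HasStrictFDerivAt (exp : 𝔸 → 𝔸) (1 : 𝔸 →L[ℝ] 𝔸) (A 0) := by
      rw [map_zero]; exact hasStrictFDerivAt_exp_zero
    exact h0.comp 0 A.hasStrictFDerivAt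
  refine (((hd A).fun_mul' (hd B)).fun_mul' (hd C)).congr_fderiv ?_
  simp only [map_zero, exp_zero, mul_one, one_smul, MulOpposite.op_one]
  abel

theorem eventually_exists_eq_exp_mul_exp_mul_exp {F : Type*} [NormedAddCommGroup F]
    [NormedSpace ℝ F] [FiniteDimensional ℝ F] (s : F →L[ℝ] 𝔸) (H M : Submodule ℝ 𝔸)
    (hsurj : ∀ a, ∃ w, ∃ h ∈ H, ∃ m ∈ M, s w + h + m = a) {p : M → Prop}
    (hp : ∀ᶠ m in 𝓝 0, p m) :
    ∀ᶠ k in 𝓝 (1 : 𝔸), ∃ w, ∃ h ∈ H, ∃ m : M, p m ∧ exp (s w) * exp h * exp (m : 𝔸) = k := by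
  have : CompleteSpace 𝔸 := FiniteDimensional.complete ℝ 𝔸
  have : CompleteSpace F := FiniteDimensional.complete ℝ F
  have hF := hasStrictFDerivAt_exp_mul_exp_mul_exp (s ∘L .fst ℝ F (H × M))
    (H.subtypeL ∘L .fst ℝ H M ∘L .snd ℝ F (H × M)) (M.subtypeL ∘L .snd ℝ H M ∘L .snd ℝ F (H × M))
  have hmap := hF.map_nhds_eq_of_surj <| LinearMap.range_eq_top.2 fun a => by
    obtain ⟨w, h, hh, m, hm, rfl⟩ := hsurj a
    exact ⟨(w, ⟨h, hh⟩, ⟨m, hm⟩), rfl⟩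
  simp only [map_zero, exp_zero, mul_one] at hmap
  rw [← hmap, eventually_map]
  have htend : Tendsto (fun p : F × H × M => p.2.2) (𝓝 0) (𝓝 0) :=
    (continuous_snd.comp continuous_snd).tendsto (0 : F × H × M)
  filter_upwards [htend.eventually hp] with q hq
  exact ⟨q.1, q.2.1, q.2.1.2, q.2.2, hq, rfl⟩

/-- Small elements of a complement of the Lie algebra do not exponentiate into `K`. -/
theorem eventually_eq_zero_of_exp_mem {K : Submonoid 𝔸}
    (hKc : IsClosed (K : Set 𝔸))
    (hKinv : ∀ a ∈ K, ∃ b ∈ K, a * b = 1 ∧ b * a = 1)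
    {M : Submodule ℝ 𝔸} (hM : Disjoint (lieDirections K hKc hKinv) M) :
    ∀ᶠ Y : M in 𝓝 0, exp (Y : 𝔸) ∈ K → Y = 0 := by
  by_contra hcon
  rw [Filter.not_eventually] at hcon
  set l : Filter M := 𝓝 0 ⊓ 𝓟 {Y | ¬ (exp (Y : 𝔸) ∈ K → Y = 0)} with hl
  have hlne : l.NeBot := Filter.frequently_iff_neBot.1 hcon
  have hmem : ∀ᶠ Y : M in l, exp (Y : 𝔸) ∈ K ∧ Y ≠ 0 :=
    (mem_inf_of_right (mem_principal_self _) : _ ∈ l) |> fun h =>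
      Filter.mem_of_superset h fun Y hY => by simpa using hY
  have hsph : ∀ᶠ Y : M in l, ‖Y‖⁻¹ • Y ∈ sphere (0 : M) 1 := hmem.mono fun Y hY => by
    rw [mem_sphere_zero_iff_norm, norm_smul, norm_inv, norm_norm,
      inv_mul_cancel₀ (norm_ne_zero_iff.2 hY.2)]
  set u := Ultrafilter.of l
  have hul : (u : Filter M) ≤ l := Ultrafilter.of_le l
  obtain ⟨Y, hY, hlim⟩ := (isCompact_sphere (0 : M) 1).ultrafilter_le_nhds
    (u.map fun Y => ‖Y‖⁻¹ • Y) (by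
      rw [le_principal_iff]
      exact hul hsph)
  have hlim' : Tendsto (fun Y : M => ‖Y‖⁻¹ • (Y : 𝔸)) u (𝓝 (Y : 𝔸)) :=
    (continuous_subtype_val.tendsto Y).comp hlim
  have h0 : Tendsto (fun Y : M => (Y : 𝔸)) u (𝓝 0) :=
    (continuous_subtype_val.tendsto (0 : M)).mono_left (hul.trans inf_le_left)
  have hYg : (Y : 𝔸) ∈ lieDirections K hKc hKinv :=
    mem_oneParamDirections_of_tendsto hKc hKinv h0 ((hmem.mono fun _ h => h.1).filter_mono hul)
      hlim'
  have : (Y : 𝔸) = 0 := Submodule.disjoint_def.1 hM _ hYg Y.2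
  have hY0 : Y = 0 := Subtype.ext this
  simp [hY0] at hY

end

section
variable {V : Type*} [NormedAddCommGroup V] [NormedSpace ℝ V] [FiniteDimensional ℝ V]

theorem exp_apply_of_apply_eq_zero {H : V →L[ℝ] V} {x : V} (h : H x = 0) : exp H x = x := by
  have : CompleteSpace V := FiniteDimensional.complete ℝ V
  have h1 := (exp_series_hasSum_exp' (𝕂 := ℝ) H).mapL (ContinuousLinearMap.apply ℝ V x)
  refine h1.unique ?_
  convert hasSum_single (0 : ℕ) ?_ using 1
  · simp
  · intro n hn
    obtain ⟨m, rfl⟩ := Nat.exists_eq_succ_of_ne_zero hn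
    simp [pow_succ, h]

theorem contDiff_exp_clm : ContDiff ℝ 1 (exp : (V →L[ℝ] V) → (V →L[ℝ] V)) := by
  have : CompleteSpace V := FiniteDimensional.complete ℝ V
  exact contDiff_iff_contDiffAt.2 fun x => (exp_analytic (𝕂 := ℝ) x).contDiffAt

end

/-- A `C¹` map whose derivative at `0` is invertible agrees near `0` with a global
`C¹` diffeomorphism. -/
theorem exists_global_diffeo_eventuallyEq {P V : Type*} [NormedAddCommGroup P] [NormedSpace ℝ P]
    [FiniteDimensional ℝ P] [NormedAddCommGroup V] [NormedSpace ℝ V]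
    {Ψ : P → V} (hΨ : ContDiff ℝ 1 Ψ) (L : P ≃L[ℝ] V)
    (hL : HasFDerivAt Ψ (L : P →L[ℝ] V) 0) :
    ∃ Φ : P ≃ₜ V, ContDiff ℝ 1 Φ ∧ ContDiff ℝ 1 Φ.symm ∧ Φ =ᶠ[𝓝 0] Ψ := by
  have : CompleteSpace P := FiniteDimensional.complete ℝ P
  have hstrict : HasStrictFDerivAt Ψ (L : P →L[ℝ] V) 0 :=
    hΨ.contDiffAt.hasStrictFDerivAt' hL one_ne_zero
  let f : ContDiffBump (0 : P) := default
  let ρ : P → P := fun z => f z • z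
  have hρ : ContDiff ℝ 1 ρ := f.contDiff.smul contDiff_id
  have hρs : HasCompactSupport ρ := f.hasCompactSupport.smul_right
  obtain ⟨C, hC⟩ := hρ.lipschitzWith_of_hasCompactSupport hρs one_ne_zero
  obtain ⟨B, hB⟩ := hρs.exists_bound_of_continuous hρ.continuous
  obtain ⟨c, hc0, hc⟩ : ∃ c : NNReal, 0 < c ∧
      (Subsingleton P ∨ c * C < ‖(L.symm : V →L[ℝ] P)‖₊⁻¹) := by
    rcases L.subsingleton_or_nnnorm_symm_pos with h | h
    · exact ⟨1, one_pos, Or.inl h⟩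
    · refine ⟨‖(L.symm : V →L[ℝ] P)‖₊⁻¹ / (C + 1), by positivity, Or.inr ?_⟩
      rw [div_mul_eq_mul_div, div_lt_iff₀ (by positivity)]
      have : 0 < ‖(L.symm : V →L[ℝ] P)‖₊⁻¹ := by positivity
      exact mul_lt_mul_of_pos_left (lt_add_one C) this
  obtain ⟨S, hS, hSa⟩ := hstrict.approximates_deriv_on_nhds (Or.inr hc0)
  obtain ⟨ε, hε, hεS⟩ := Metric.mem_nhds_iff.1 hS
  obtain ⟨r, hr, hrB⟩ : ∃ r : ℝ, 0 < r ∧ r * B < ε := by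
    refine ⟨ε / (|B| + 1), by positivity, ?_⟩
    rw [div_mul_eq_mul_div, div_lt_iff₀ (by positivity)]
    exact mul_lt_mul_of_pos_left ((le_abs_self B).trans_lt (lt_add_one _)) hε
  let ρr : P → P := fun z => r • ρ (r⁻¹ • z)
  have hρr : ContDiff ℝ 1 ρr := (hρ.comp (contDiff_const_smul r⁻¹)).const_smul r
  have hρrS : ∀ z, ρr z ∈ S := fun z => hεS <| by
    rw [mem_ball_zero_iff, norm_smul, Real.norm_of_nonneg hr.le]
    exact (mul_le_mul_of_nonneg_left (hB _) hr.le).trans_lt hrB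
  have hρrL : ∀ z w, ‖ρr z - ρr w‖ ≤ C * ‖z - w‖ := fun z w => by
    rw [← smul_sub, norm_smul, Real.norm_of_nonneg hr.le]
    have h := hC.norm_sub_le (r⁻¹ • z) (r⁻¹ • w)
    rw [← smul_sub, norm_smul, norm_inv, Real.norm_of_nonneg hr.le] at h
    calc r * ‖ρ (r⁻¹ • z) - ρ (r⁻¹ • w)‖ ≤ r * (C * (r⁻¹ * ‖z - w‖)) := by gcongr
      _ = C * ‖z - w‖ := by field_simp
  let Φ : P → V := fun z => L z + (Ψ (ρr z) - L (ρr z))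
  have hΦ : ContDiff ℝ 1 Φ :=
    L.contDiff.add ((hΨ.comp hρr).sub (L.contDiff.comp hρr))
  have hΦa : ApproximatesLinearOn Φ (L : P →L[ℝ] V) Set.univ (c * C) := fun z _ w _ => by
    have h := hSa _ (hρrS z) _ (hρrS w)
    have h1 : Φ z - Φ w - (L : P →L[ℝ] V) (z - w) =
        Ψ (ρr z) - Ψ (ρr w) - (L : P →L[ℝ] V) (ρr z - ρr w) := by
      simp only [Φ, ContinuousLinearEquiv.coe_coe, map_sub]; abel
    rw [h1]
    calc _ ≤ c * ‖ρr z - ρr w‖ := h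
      _ ≤ c * (C * ‖z - w‖) := by gcongr; exact hρrL z w
      _ = _ := by push_cast; ring
  have hbij : ∀ z, ∃ D : P ≃L[ℝ] V, HasFDerivAt Φ (D : P →L[ℝ] V) z := fun z => by
    have hD := (hΦ.differentiable one_ne_zero z).hasFDerivAt
    have hle : ‖fderiv ℝ Φ z - (L : P →L[ℝ] V)‖ ≤ (c * C : NNReal) := by
      refine (hD.sub (L : P →L[ℝ] V).hasFDerivAt).le_of_lipschitz (C := c * C) ?_
      refine LipschitzWith.of_dist_le_mul fun u v => ?_
      rw [dist_eq_norm, dist_eq_norm]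
      refine le_trans (le_of_eq ?_) (hΦa u trivial v trivial)
      congr 1
      simp only [Pi.sub_apply, map_sub]; abel
    have hDa : ApproximatesLinearOn (fderiv ℝ Φ z) (L : P →L[ℝ] V) Set.univ (c * C) :=
      fun u _ v _ => by
        rw [← map_sub, ← sub_apply]
        exact ContinuousLinearMap.le_of_opNorm_le _ hle _
    have hinj : Function.Injective (fderiv ℝ Φ z) := Set.injOn_univ.1 (hDa.injOn hc)
    have hsurj : Function.Surjective (fderiv ℝ Φ z) := hDa.surjective hc
    refine ⟨(LinearEquiv.ofBijective (fderiv ℝ Φ z).toLinearMap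
      ⟨hinj, hsurj⟩).toContinuousLinearEquiv, ?_⟩
    exact hD.congr_fderiv (by ext; rfl)
  choose D hD using hbij
  refine ⟨hΦa.toHomeomorph Φ hc, hΦ, Homeomorph.contDiff_symm _ hD hΦ, ?_⟩
  have h1 : Tendsto (fun z : P => r⁻¹ • z) (𝓝 0) (𝓝 0) := by
    simpa using (continuous_const_smul r⁻¹).tendsto (0 : P)
  filter_upwards [h1.eventually f.eventuallyEq_one] with z hz
  change Φ z = Ψ z
  have : ρr z = z := by
    simp only [ρr, ρ, hz, Pi.one_apply, one_smul]
    rw [smul_inv_smul₀ hr.ne']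
  simp [Φ, this]

section
variable {V : Type*} [NormedAddCommGroup V] [NormedSpace ℝ V] [FiniteDimensional ℝ V]

/-- The tangent space at `x` of the orbit of `x` under `K`. -/
def orbitTangent (K : Submonoid (V →L[ℝ] V)) (hKc : IsClosed (K : Set (V →L[ℝ] V)))
    (hKinv : ∀ a ∈ K, ∃ b ∈ K, a * b = 1 ∧ b * a = 1) (x : V) : Submodule ℝ V :=
  (lieDirections K hKc hKinv).map (ContinuousLinearMap.apply ℝ V x).toLinearMap

theorem exists_section_orbitTangent (K : Submonoid (V →L[ℝ] V))
    (hKc : IsClosed (K : Set (V →L[ℝ] V)))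
    (hKinv : ∀ a ∈ K, ∃ b ∈ K, a * b = 1 ∧ b * a = 1) (x : V) :
    ∃ s : orbitTangent K hKc hKinv x →L[ℝ] (V →L[ℝ] V),
      ∀ w, s w ∈ lieDirections K hKc hKinv ∧ s w x = w := by
  obtain ⟨s, hs⟩ := LinearMap.exists_rightInverse_of_surjective
    ((ContinuousLinearMap.apply ℝ V x).toLinearMap.submoduleMap (lieDirections K hKc hKinv))
    (LinearMap.range_eq_top.2 (LinearMap.submoduleMap_surjective _ _))
  refine ⟨((lieDirections K hKc hKinv).subtype ∘ₗ s).toContinuousLinearMap, fun w => ?_⟩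
  refine ⟨(s w).2, ?_⟩
  exact congrArg Subtype.val (LinearMap.congr_fun hs w)

theorem eventually_apply_mem_range (K : Submonoid (V →L[ℝ] V))
    (hKc : IsClosed (K : Set (V →L[ℝ] V)))
    (hKinv : ∀ a ∈ K, ∃ b ∈ K, a * b = 1 ∧ b * a = 1) (x : V)
    (s : orbitTangent K hKc hKinv x →L[ℝ] (V →L[ℝ] V))
    (hs : ∀ w, s w ∈ lieDirections K hKc hKinv ∧ s w x = w) :
    ∀ᶠ k in 𝓝 (1 : V →L[ℝ] V), k ∈ K → ∃ w, exp (s w) x = k x := by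
  have : CompleteSpace V := FiniteDimensional.complete ℝ V
  let +nondep : NormedAlgebra ℚ (V →L[ℝ] V) := .restrictScalars ℚ ℝ (V →L[ℝ] V)
  set g := lieDirections K hKc hKinv with hg
  let H : Submodule ℝ (V →L[ℝ] V) :=
    g ⊓ LinearMap.ker (ContinuousLinearMap.apply ℝ V x).toLinearMap
  obtain ⟨M, hM⟩ := Submodule.exists_isCompl g
  have hsurj : ∀ a : V →L[ℝ] V, ∃ w, ∃ h ∈ H, ∃ m ∈ M, s w + h + m = a := fun a => by
    obtain ⟨b, hb, m, hm, rfl⟩ := Submodule.mem_sup.1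
      (hM.sup_eq_top ▸ Submodule.mem_top : a ∈ g ⊔ M)
    refine ⟨⟨b x, b, hb, rfl⟩, b - s ⟨b x, b, hb, rfl⟩, ⟨sub_mem hb (hs _).1, ?_⟩, m, hm,
      by abel⟩
    change b x - s ⟨b x, b, hb, rfl⟩ x = 0
    rw [(hs _).2, sub_self]
  have hcancel : ∀ A : V →L[ℝ] V, exp (-A) * exp A = 1 := fun A => by
    rw [← exp_add_of_commute (Commute.neg_left (Commute.refl A))]; simp
  filter_upwards [eventually_exists_eq_exp_mul_exp_mul_exp s H M hsurj
    (eventually_eq_zero_of_exp_mem hKc hKinv hM.disjoint)] with k hk hkK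
  obtain ⟨w, h, hh, m, hm, rfl⟩ := hk
  have hm0 : m = 0 := hm <| by
    have h4 : exp (m : V →L[ℝ] V) =
        exp (-h) * (exp (-(s w)) * (exp (s w) * exp h * exp (m : V →L[ℝ] V))) := by
      rw [mul_assoc (exp (s w)), ← mul_assoc (exp (-s w)), hcancel, one_mul,
        ← mul_assoc, hcancel, one_mul]
    rw [h4]
    exact mul_mem (exp_mem_of_mem_lieDirections (neg_mem hh.1))
      (mul_mem (exp_mem_of_mem_lieDirections (neg_mem (hs _).1)) hkK)
  refine ⟨w, ?_⟩
  simp only [hm0, ZeroMemClass.coe_zero, exp_zero, mul_one, mul_apply_eq_comp]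
  rw [exp_apply_of_apply_eq_zero (H := h) hh.2]

theorem dimH_image_apply_le (K : Submonoid (V →L[ℝ] V))
    (hKcpt : IsCompact (K : Set (V →L[ℝ] V)))
    (hKinv : ∀ a ∈ K, ∃ b ∈ K, a * b = 1 ∧ b * a = 1) (x : V) :
    dimH ((fun k : V →L[ℝ] V => k x) '' K) ≤
      Module.finrank ℝ (orbitTangent K hKcpt.isClosed hKinv x) := by
  obtain ⟨s, hs⟩ := exists_section_orbitTangent K hKcpt.isClosed hKinv x
  have hev := eventually_apply_mem_range K hKcpt.isClosed hKinv x s hs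
  refine (dimH_mono (Set.image_mono (Set.inter_self (K : Set (V →L[ℝ] V))).ge)).trans ?_
  refine hKcpt.induction_on (p := fun S => dimH ((fun k : V →L[ℝ] V => k x) '' (K ∩ S)) ≤
      Module.finrank ℝ (orbitTangent K hKcpt.isClosed hKinv x)) (by simp) ?_ ?_ ?_
  · exact fun S T hST hT => (dimH_mono (Set.image_mono (Set.inter_subset_inter_right _ hST))).trans hT
  · intro S T hS hT
    rw [Set.inter_union_distrib_left, Set.image_union, dimH_union]
    exact max_le hS hT
  · intro k hk
    obtain ⟨b, hb, hkb, hbk⟩ := hKinv k hk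
    have hcont : Tendsto (fun h : V →L[ℝ] V => b * h) (𝓝 k) (𝓝 1) := by
      rw [← hbk]; exact (continuous_const_mul b).tendsto k
    refine ⟨_, mem_nhdsWithin_of_mem_nhds (hcont.eventually hev), ?_⟩
    have hC : ContDiff ℝ 1 (fun w : orbitTangent K hKcpt.isClosed hKinv x => k (exp (s w) x)) :=
      k.contDiff.comp ((contDiff_exp_clm.comp s.contDiff).clm_apply contDiff_const)
    refine (dimH_mono ?_).trans hC.dimH_range_le
    rintro _ ⟨h, ⟨hhK, hh⟩, rfl⟩
    obtain ⟨w, hw⟩ := hh (mul_mem hb hhK)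
    refine ⟨w, ?_⟩
    simp only [hw]
    rw [← mul_apply_eq_comp, ← mul_assoc, hkb, one_mul]

end

/-- The linear maps on `ℝ^n` given by the matrices of `G`. -/
def linearImage {n : ℕ} (G : Subgroup (Matrix.orthogonalGroup (Fin n) ℝ)) :
    Submonoid (E n →L[ℝ] E n) :=
  G.toSubmonoid.map ((Matrix.toEuclideanCLM (n := Fin n) (𝕜 := ℝ) :
    Matrix (Fin n) (Fin n) ℝ →* (E n →L[ℝ] E n)).comp
      (Matrix.orthogonalGroup (Fin n) ℝ).subtype)

theorem mem_linearImage {n : ℕ} {G : Subgroup (Matrix.orthogonalGroup (Fin n) ℝ)}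
    {k : E n →L[ℝ] E n} : k ∈ linearImage G ↔
      ∃ g ∈ G, Matrix.toEuclideanCLM (n := Fin n) (𝕜 := ℝ) (g : Matrix (Fin n) (Fin n) ℝ) = k :=
  Iff.rfl

theorem orbitSet_eq_image {n : ℕ} (G : Subgroup (Matrix.orthogonalGroup (Fin n) ℝ)) (x : E n) :
    orbitSet G x = (fun k : E n →L[ℝ] E n => k x) '' (linearImage G) := by
  ext y
  constructor
  · rintro ⟨g, hg, h⟩
    refine ⟨_, mem_linearImage.2 ⟨g, hg, rfl⟩, ?_⟩
    ext i
    simp [← h]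
  · rintro ⟨_, ⟨g, hg, rfl⟩, rfl⟩
    exact ⟨g, hg, rfl⟩

theorem isCompact_linearImage {n : ℕ} {G : Subgroup (Matrix.orthogonalGroup (Fin n) ℝ)}
    (hG : IsCompact (G : Set (Matrix.orthogonalGroup (Fin n) ℝ))) :
    IsCompact (linearImage G : Set (E n →L[ℝ] E n)) := by
  have hc : Continuous (Matrix.toEuclideanCLM (n := Fin n) (𝕜 := ℝ)) :=
    LinearMap.continuous_of_finiteDimensional
      (Matrix.toEuclideanCLM (n := Fin n) (𝕜 := ℝ)).toAlgEquiv.toLinearMap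
  exact hG.image (hc.comp continuous_subtype_val)

theorem exists_inv_mem_linearImage {n : ℕ} {G : Subgroup (Matrix.orthogonalGroup (Fin n) ℝ)} :
    ∀ a ∈ linearImage G, ∃ b ∈ linearImage G, a * b = 1 ∧ b * a = 1 := by
  rintro _ ⟨g, hg, rfl⟩
  refine ⟨_, ⟨g⁻¹, G.inv_mem hg, rfl⟩, ?_, ?_⟩
  · rw [← map_mul, mul_inv_cancel, map_one]
  · rw [← map_mul, inv_mul_cancel, map_one]

/-- If the tangent space of the orbit of `x` has dimension at least `δ`, there is a global
parametrization of `ℝ^n` whose `δ`-dimensional slices lie, near `x`, in orbits. -/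
theorem exists_orbit_parametrization {n δ : ℕ} {K : Submonoid (E n →L[ℝ] E n)}
    (hKc : IsClosed (K : Set (E n →L[ℝ] E n)))
    (hKinv : ∀ a ∈ K, ∃ b ∈ K, a * b = 1 ∧ b * a = 1) (x : E n) (hδn : δ ≤ n)
    (hδ : δ ≤ Module.finrank ℝ (orbitTangent K hKc hKinv x)) :
    ∃ Φ : (E δ × E (n - δ)) ≃ₜ E n, ContDiff ℝ 1 Φ ∧ ContDiff ℝ 1 Φ.symm ∧ Φ 0 = x ∧
      ∃ q : E (n - δ) → E n, ∀ᶠ p in 𝓝 (0 : E δ × E (n - δ)), ∃ k ∈ K, Φ p = k (q p.2) := by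
  obtain ⟨s, hs⟩ := exists_section_orbitTangent K hKc hKinv x
  obtain ⟨i, hi⟩ : ∃ f : E δ →ₗ[ℝ] orbitTangent K hKc hKinv x, Function.Injective f :=
    finrank_le_iff_exists_linearMap.1 (by simpa using hδ)
  let j : E δ →ₗ[ℝ] E n := (orbitTangent K hKc hKinv x).subtype ∘ₗ i
  have hj : Function.Injective j := Subtype.val_injective.comp hi
  obtain ⟨C, hC⟩ := Submodule.exists_isCompl (LinearMap.range j)
  have hCdim : Module.finrank ℝ (E (n - δ)) = Module.finrank ℝ C := by
    have h1 := Submodule.finrank_add_eq_of_isCompl hC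
    rw [LinearMap.finrank_range_of_inj hj] at h1
    simp only [finrank_euclideanSpace_fin] at h1 ⊢
    omega
  let e : E (n - δ) ≃ₗ[ℝ] C := LinearEquiv.ofFinrankEq _ _ hCdim
  let m : E (n - δ) →ₗ[ℝ] E n := C.subtype ∘ₗ e.toLinearMap
  have hinj : Function.Injective (j.coprod m) := by
    rw [← LinearMap.ker_eq_bot, LinearMap.ker_eq_bot']
    rintro ⟨t, v⟩ htv
    have htv' : j t + e v = 0 := by simpa [m] using htv
    have hjt : j t ∈ C := by
      rw [eq_neg_of_add_eq_zero_left htv']; exact neg_mem (e v).2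
    have hj0 : j t = 0 := Submodule.disjoint_def.1 hC.disjoint _ ⟨t, rfl⟩ hjt
    have ht : t = 0 := hj (by rw [hj0, map_zero])
    have hv : e v = 0 := Subtype.ext (by simpa [hj0] using htv')
    rw [ht, (map_eq_zero_iff e e.injective).1 hv]; rfl
  have hdim : Module.finrank ℝ (E δ × E (n - δ)) = Module.finrank ℝ (E n) := by
    simp [hδn]
  let L : (E δ × E (n - δ)) ≃L[ℝ] E n :=
    (LinearEquiv.ofInjectiveOfFinrankEq _ hinj hdim).toContinuousLinearEquiv
  let A : (E δ × E (n - δ)) →L[ℝ] (E n →L[ℝ] E n) :=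
    s ∘L i.toContinuousLinearMap ∘L .fst ℝ _ _
  let B : (E δ × E (n - δ)) →L[ℝ] E n := m.toContinuousLinearMap ∘L .snd ℝ _ _
  let Ψ : (E δ × E (n - δ)) → E n := fun p => exp (A p) (x + B p)
  have hΨ : ContDiff ℝ 1 Ψ :=
    (contDiff_exp_clm.comp A.contDiff).clm_apply (contDiff_const.add B.contDiff)
  have hΨL : HasFDerivAt Ψ (L : (E δ × E (n - δ)) →L[ℝ] E n) 0 := by
    have h0 : HasFDerivAt (exp : (E n →L[ℝ] E n) → (E n →L[ℝ] E n))
        (1 : (E n →L[ℝ] E n) →L[ℝ] (E n →L[ℝ] E n)) (A 0) := by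
      rw [map_zero]; exact hasFDerivAt_exp_zero
    refine ((h0.comp 0 A.hasFDerivAt).clm_apply
      (B.hasFDerivAt.const_add x)).congr_fderiv ?_
    refine ContinuousLinearMap.ext fun p => ?_
    change exp (A 0) (B p) + (A p) (x + B 0) = j p.1 + m p.2
    rw [map_zero, map_zero, exp_zero, add_zero, add_comm]
    exact congrArg (· + m p.2) (hs (i p.1)).2
  obtain ⟨Φ, h1, h2, h3⟩ := exists_global_diffeo_eventuallyEq hΨ L hΨL
  refine ⟨Φ, h1, h2, ?_, fun v => x + m v, h3.mono fun p hp => ?_⟩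
  · rw [h3.self_of_nhds]
    simp [Ψ]
  · exact ⟨exp (A p), exp_mem_of_mem_lieDirections (hs _).1, hp⟩

/-- Hebey–Vaugon chart lemma: if `Ω` is a bounded (C¹) domain in `ℝ^N`, `G` a compact
subgroup of `O(N)`, `x ∈ Ω` and `δ = dim O^x_G ≥ 1` (dimension read as Hausdorff
dimension of the orbit), then there is a chart `(A, φ)` of `Ω` at `x` with `φ` a `C¹`
diffeomorphism onto `ℝ^δ × ℝ^{N-δ}`, `φ(A) = U × V` with `U ⊆ ℝ^δ`, `V ⊆ ℝ^{N-δ}` open,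
and `U × Π₂(φ(y)) ⊆ φ(O^y_G ∩ A)` for every `y ∈ A`. -/
theorem hebey_vaugon_chart (N δ : ℕ) (hδ1 : 1 ≤ δ) (hδN : δ ≤ N)
    (Ω : Set (E N)) (hΩo : IsOpen Ω) (hΩb : IsBounded Ω)
    (G : Subgroup (Matrix.orthogonalGroup (Fin N) ℝ))
    (hGc : IsCompact (G : Set (Matrix.orthogonalGroup (Fin N) ℝ)))
    (x : E N) (hx : x ∈ Ω) (hdim : dimH (orbitSet G x) = δ) :
    ∃ (A : Set (E N)) (φ : E N → E δ × E (N - δ)) (ψ : E δ × E (N - δ) → E N),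
      x ∈ A ∧ IsOpen A ∧ A ⊆ Ω ∧
      ContDiff ℝ 1 φ ∧ ContDiff ℝ 1 ψ ∧
      Function.LeftInverse ψ φ ∧ Function.RightInverse ψ φ ∧
      ∃ (U : Set (E δ)) (V : Set (E (N - δ))),
        IsOpen U ∧ IsOpen V ∧ φ '' A = U ×ˢ V ∧
        ∀ y ∈ A, U ×ˢ ({(φ y).2} : Set (E (N - δ))) ⊆ φ '' (orbitSet G y ∩ A) := by
  have hKcpt := isCompact_linearImage hGc
  have hKinv := exists_inv_mem_linearImage (G := G)
  have hδ : δ ≤ Module.finrank ℝ (orbitTangent (linearImage G) hKcpt.isClosed hKinv x) := by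
    have h := dimH_image_apply_le (linearImage G) hKcpt hKinv x
    rw [← orbitSet_eq_image, hdim] at h
    exact_mod_cast h
  obtain ⟨Φ, hΦ, hΦs, hΦ0, q, hq⟩ :=
    exists_orbit_parametrization hKcpt.isClosed hKinv x hδN hδ
  have hΩ0 : ∀ᶠ p in 𝓝 (0 : E δ × E (N - δ)), Φ p ∈ Ω :=
    Φ.continuous.tendsto 0 (by rw [hΦ0]; exact hΩo.mem_nhds hx)
  obtain ⟨U, V, hUo, hU0, hVo, hV0, hUV⟩ := mem_nhds_prod_iff'.1 (hq.and hΩ0)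
  refine ⟨Φ.symm ⁻¹' (U ×ˢ V), Φ.symm, Φ, ?_, (hUo.prod hVo).preimage Φ.symm.continuous, ?_,
    hΦs, hΦ, Φ.apply_symm_apply, Φ.symm_apply_apply, U, V, hUo, hVo,
    Set.image_preimage_eq _ Φ.symm.surjective, ?_⟩
  · rw [Set.mem_preimage, ← hΦ0, Φ.symm_apply_apply]
    exact ⟨hU0, hV0⟩
  · intro y hy
    simpa using (hUV hy).2
  · rintro y hy ⟨t, v⟩ ⟨ht, hv⟩
    obtain rfl : v = (Φ.symm y).2 := hv
    have htV : ((t, (Φ.symm y).2) : E δ × E (N - δ)) ∈ U ×ˢ V := ⟨ht, hy.2⟩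
    refine ⟨Φ (t, (Φ.symm y).2), ⟨?_, ?_⟩, Φ.symm_apply_apply _⟩
    · obtain ⟨a, ha, hya⟩ := (hUV hy).1
      obtain ⟨c, hc, hyc⟩ := (hUV htV).1
      obtain ⟨b, hb, -, hba⟩ := hKinv a ha
      rw [orbitSet_eq_image]
      refine ⟨c * b, mul_mem hc hb, ?_⟩
      rw [Φ.apply_symm_apply] at hya
      have hby : b y = q (Φ.symm y).2 :=
        (congrArg b hya).trans (DFunLike.congr_fun hba (q (Φ.symm y).2))
      change c (b y) = _
      rw [hby, hyc]
    · rwa [Set.mem_preimage, Φ.symm_apply_apply]
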